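/- arXiv:1701.07638 — 9 statements merged into one kernel-verified Lean document; each statement's English description precedes it below -/
import Mathlib

section
/- If σ_L > 0, then for every fixed ρ ∈ (−1,1) and fixed n ≥ 1 the bullwhip measure is strictly decreasing in the lead-time-forecast window m: for all integers 1 ≤ m₁ < m₂, BM(ρ, n, m₂) < BM(ρ, n, m₁). -/
open Filter Topology

/-- The bullwhip measure `BM(ρ, n, m)` for AR(1) demand with autocorrelation `ρ`,
demand mean `μD` and standard deviation `σD`, lead time mean `μL` and standard
deviation `σL`, when `n` past demands and `m` past lead times are used in the
moving-average forecasts. -/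
noncomputable def BM (ρ : ℝ) (n m : ℕ) (μD σD μL σL : ℝ) : ℝ :=
  (2 * σL ^ 2 / ((n : ℝ) ^ 2 * (m : ℝ) ^ 2)) *
      ((m : ℝ) * (1 - ρ ^ n) + (n : ℝ) * (1 + ρ) / (1 - ρ)
        - (1 + ρ ^ 2) * (1 - ρ ^ n) / (1 - ρ) ^ 2)
    + 2 * σL ^ 2 * μD ^ 2 / (σD ^ 2 * (m : ℝ) ^ 2)
    + (2 * μL ^ 2 / (n : ℝ) ^ 2 + 2 * μL / (n : ℝ)) * (1 - ρ ^ n) + 1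

/-- The coefficients `a` of `1 / m` and `b` of `1 / m ^ 2` in the bullwhip measure satisfy
`a + 3 / 2 * b > 0`; this follows from Bernoulli's inequality. -/
lemma bullwhip_coeff_pos {n : ℕ} (hn : 1 ≤ n) {ρ : ℝ} (hρ₁ : -1 < ρ) (hρ₂ : ρ < 1) :
    0 < (1 - ρ ^ n) + 3 / 2 * ((n : ℝ) * (1 + ρ) / (1 - ρ)
        - (1 + ρ ^ 2) * (1 - ρ ^ n) / (1 - ρ) ^ 2) := by
  have hn' : (1 : ℝ) ≤ n := by exact_mod_cast hn
  have hr : 0 < 1 - ρ := by linarith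
  have hA : 0 < 1 - ρ ^ n := by
    have : |ρ| ^ n < 1 := pow_lt_one₀ (abs_nonneg ρ) (abs_lt.2 ⟨hρ₁, hρ₂⟩) (by omega)
    rw [← abs_pow] at this
    linarith [le_abs_self (ρ ^ n)]
  have hB : 1 - ρ ^ n ≤ n * (1 - ρ) := by
    have := one_add_mul_le_pow (a := ρ - 1) (by linarith) n
    rw [add_sub_cancel] at this
    linarith
  generalize ρ ^ n = p at *
  have key : 0 < 3 / 2 * n * (1 - ρ) * (1 + ρ) - (1 - p) * (1 / 2 + 2 * ρ + 1 / 2 * ρ ^ 2) := by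
    have h1 : 0 < n * (1 - ρ) := by positivity
    rcases le_or_gt (1 / 2 + 2 * ρ + 1 / 2 * ρ ^ 2) 0 with hg | hg
    · nlinarith [mul_nonneg hA.le (neg_nonneg.2 hg), mul_pos h1 (by linarith : 0 < 1 + ρ)]
    · have h2 := mul_le_mul_of_nonneg_right hB hg.le
      have h3 : 0 < n * (1 - ρ) * ((1 - ρ) * (2 + ρ)) :=
        mul_pos h1 (mul_pos hr (by linarith))
      nlinarith
  have e : (1 - p) + 3 / 2 * ((n : ℝ) * (1 + ρ) / (1 - ρ) - (1 + ρ ^ 2) * (1 - p) / (1 - ρ) ^ 2)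
      = (3 / 2 * n * (1 - ρ) * (1 + ρ) - (1 - p) * (1 / 2 + 2 * ρ + 1 / 2 * ρ ^ 2))
        / (1 - ρ) ^ 2 := by
    field_simp
    ring
  rw [e]
  positivity

/-- If `σ_L > 0`, the bullwhip measure is strictly decreasing in the
lead-time-forecast window `m`. -/
theorem bullwhip_strict_anti_m (n : ℕ) (hn : 1 ≤ n) (μD σD μL σL : ℝ) (hσD : 0 < σD)
    (hμL : 0 ≤ μL) (hσL : 0 < σL) (ρ : ℝ) (hρ₁ : -1 < ρ) (hρ₂ : ρ < 1) :
    ∀ m₁ m₂ : ℕ, 1 ≤ m₁ → m₁ < m₂ →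
      BM ρ n m₂ μD σD μL σL < BM ρ n m₁ μD σD μL σL := by
  intro m₁ m₂ h₁ h₁₂
  have hn' : (0 : ℝ) < n := by exact_mod_cast hn
  have hm₁ : (1 : ℝ) ≤ m₁ := by exact_mod_cast h₁
  have hm₁₂ : (m₁ : ℝ) + 1 ≤ m₂ := by exact_mod_cast h₁₂
  have hA : 0 < 1 - ρ ^ n := by
    have : |ρ| ^ n < 1 := pow_lt_one₀ (abs_nonneg ρ) (abs_lt.2 ⟨hρ₁, hρ₂⟩) (by omega)
    rw [← abs_pow] at this
    linarith [le_abs_self (ρ ^ n)]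
  have hAB := bullwhip_coeff_pos hn hρ₁ hρ₂
  unfold BM
  rw [add_sub_assoc, add_sub_assoc]
  generalize (n : ℝ) * (1 + ρ) / (1 - ρ) - (1 + ρ ^ 2) * (1 - ρ ^ n) / (1 - ρ) ^ 2 = B at *
  generalize 1 - ρ ^ n = A at *
  have hx₁ : (m₁ : ℝ)⁻¹ ≤ 1 := inv_le_one_of_one_le₀ hm₁
  have hx₂ : (m₂ : ℝ)⁻¹ ≤ 1 / 2 := by
    rw [one_div]
    exact inv_anti₀ (by norm_num) (by linarith)
  have hx₁₂ : (m₂ : ℝ)⁻¹ < (m₁ : ℝ)⁻¹ := inv_strictAnti₀ (by linarith) (by linarith)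
  have hx₀ : 0 < (m₂ : ℝ)⁻¹ := inv_pos.2 (by linarith)
  have form : ∀ m : ℝ, m ≠ 0 →
      2 * σL ^ 2 / ((n : ℝ) ^ 2 * m ^ 2) * (m * A + B) + 2 * σL ^ 2 * μD ^ 2 / (σD ^ 2 * m ^ 2)
        = 2 * σL ^ 2 / (n : ℝ) ^ 2 * (A * m⁻¹ + B * m⁻¹ ^ 2)
          + 2 * σL ^ 2 * μD ^ 2 / σD ^ 2 * m⁻¹ ^ 2 := by
    intro m hm
    field_simp
  rw [form m₁ (by linarith), form m₂ (by linarith)]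
  generalize (m₁ : ℝ)⁻¹ = x at *
  generalize (m₂ : ℝ)⁻¹ = y at *
  have hpos : 0 < A + B * (x + y) := by
    rcases le_or_gt 0 B with hB | hB
    · have := mul_nonneg hB (by linarith : 0 ≤ x + y)
      linarith
    · nlinarith
  have h1 : A * y + B * y ^ 2 < A * x + B * x ^ 2 := by
    nlinarith [mul_pos (sub_pos.2 hx₁₂) hpos]
  have h2 : y ^ 2 ≤ x ^ 2 := by gcongr
  have h3 := mul_lt_mul_of_pos_left h1 (by positivity : 0 < 2 * σL ^ 2 / (n : ℝ) ^ 2)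
  have h4 := mul_le_mul_of_nonneg_left h2 (by positivity : 0 ≤ 2 * σL ^ 2 * μD ^ 2 / σD ^ 2)
  linarith
end

section
/- When n = 1 the gradient of the bullwhip measure in ρ is nonpositive, namely d BM(ρ, 1, m)/dρ = −2μ_L(μ_L+1) − 2σ_L²(m−1)/m² ≤ 0 for all ρ ∈ (−1,1); it is strictly negative whenever μ_L > 0 or (m ≥ 2 and σ_L > 0), and it equals zero when μ_L = 0 and m = 1. -/
open Filter Topology

/-- For `n = 1` and `ρ ≠ 1` the bullwhip measure is affine in `ρ`. -/
theorem BM_one_eq_affine {ρ : ℝ} (hρ : ρ ≠ 1) (m : ℕ) (μD σD μL σL : ℝ) :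
    BM ρ 1 m μD σD μL σL =
      (-(2 * μL * (μL + 1)) - 2 * σL ^ 2 * ((m : ℝ) - 1) / (m : ℝ) ^ 2) * ρ
        + (2 * σL ^ 2 / (m : ℝ) ^ 2 * m + 2 * σL ^ 2 * μD ^ 2 / (σD ^ 2 * (m : ℝ) ^ 2)
          + (2 * μL ^ 2 + 2 * μL) + 1) := by
  have h : 1 - ρ ≠ 0 := sub_ne_zero.mpr hρ.symm
  have key : (m : ℝ) * (1 - ρ) + (1 + ρ) / (1 - ρ) - (1 + ρ ^ 2) * (1 - ρ) / (1 - ρ) ^ 2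
      = m * (1 - ρ) + ρ := by
    field_simp
    ring
  simp only [BM, Nat.cast_one, one_pow, pow_one, one_mul, div_one, key]
  ring

/-- When `n = 1` the gradient of the bullwhip measure in `ρ` is
`-2μ_L(μ_L+1) - 2σ_L²(m-1)/m² ≤ 0`: strictly negative when `μ_L > 0` or
(`m ≥ 2` and `σ_L > 0`), and zero when `μ_L = 0` and `m = 1`. -/
theorem bullwhip_n_eq_one_deriv (m : ℕ) (hm : 1 ≤ m) (μD σD μL σL : ℝ) (hσD : 0 < σD)
    (hμL : 0 ≤ μL) (hσL : 0 ≤ σL) :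
    (∀ ρ : ℝ, -1 < ρ → ρ < 1 →
        HasDerivAt (fun x : ℝ => BM x 1 m μD σD μL σL)
          (-(2 * μL * (μL + 1)) - 2 * σL ^ 2 * ((m : ℝ) - 1) / (m : ℝ) ^ 2) ρ) ∧
      (-(2 * μL * (μL + 1)) - 2 * σL ^ 2 * ((m : ℝ) - 1) / (m : ℝ) ^ 2 ≤ 0) ∧
      ((0 < μL ∨ (2 ≤ m ∧ 0 < σL)) →
        -(2 * μL * (μL + 1)) - 2 * σL ^ 2 * ((m : ℝ) - 1) / (m : ℝ) ^ 2 < 0) ∧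
      ((μL = 0 ∧ m = 1) →
        -(2 * μL * (μL + 1)) - 2 * σL ^ 2 * ((m : ℝ) - 1) / (m : ℝ) ^ 2 = 0) := by
  have hm' : (1 : ℝ) ≤ m := by exact_mod_cast hm
  have hlead : 0 ≤ 2 * μL * (μL + 1) := by positivity
  have hvar : 0 ≤ 2 * σL ^ 2 * ((m : ℝ) - 1) / (m : ℝ) ^ 2 :=
    div_nonneg (mul_nonneg (by positivity) (sub_nonneg.mpr hm')) (by positivity)
  refine ⟨fun ρ _ hρ => ?_, by linarith, ?_, ?_⟩
  · refine HasDerivAt.congr_of_eventuallyEq ?_ ((eventually_ne_nhds hρ.ne).mono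
      fun x hx => BM_one_eq_affine hx m μD σD μL σL)
    simpa only [mul_one] using HasDerivAt.add_const _ (HasDerivAt.const_mul
      (-(2 * μL * (μL + 1)) - 2 * σL ^ 2 * ((m : ℝ) - 1) / (m : ℝ) ^ 2) (hasDerivAt_id' ρ))
  · rintro (h | ⟨h2, h⟩)
    · have : 0 < 2 * μL * (μL + 1) := by positivity
      linarith
    · have h2' : (2 : ℝ) ≤ m := by exact_mod_cast h2
      have : 0 < 2 * σL ^ 2 * ((m : ℝ) - 1) / (m : ℝ) ^ 2 :=
        div_pos (mul_pos (by positivity) (by linarith)) (by positivity)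
      linarith
  · rintro ⟨rfl, rfl⟩
    simp
end

section
/- If μ_L > 0 or σ_L > 0, then the i.i.d.-demand bullwhip measure BM_iid(n, m) = 1 + 2μ_D²σ_L²/(m²σ_D²) + 2σ_L²(m+n−1)/(m²n²) + 2μ_L(μ_L+n)/n² is strictly decreasing in n for each fixed m, and if σ_L > 0 it is strictly decreasing in m for each fixed n: i.e. BM_iid(n₂, m) < BM_iid(n₁, m) for 1 ≤ n₁ < n₂ (when μ_L > 0 or σ_L > 0), and BM_iid(n, m₂) < BM_iid(n, m₁) for 1 ≤ m₁ < m₂ (when σ_L > 0). -/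
/-- The bullwhip measure for i.i.d. demand. -/
noncomputable def BMiid (n m : ℕ) (μD σD μL σL : ℝ) : ℝ :=
  1 + 2 * μD ^ 2 * σL ^ 2 / ((m : ℝ) ^ 2 * σD ^ 2)
    + 2 * σL ^ 2 * ((m : ℝ) + (n : ℝ) - 1) / ((m : ℝ) ^ 2 * (n : ℝ) ^ 2)
    + 2 * μL * (μL + (n : ℝ)) / (n : ℝ) ^ 2

theorem add_div_sq_lt_add_div_sq {c x y : ℝ} (hc : 0 ≤ c) (hx : 0 < x) (hxy : x < y) :
    (c + y) / y ^ 2 < (c + x) / x ^ 2 := by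
  have hy : 0 < y := hx.trans hxy
  rw [div_lt_div_iff₀ (by positivity) (by positivity)]
  have h₁ : c * x ^ 2 ≤ c * y ^ 2 := by gcongr
  have h₂ : x * y * x < x * y * y := by gcongr
  linarith

theorem BMiid_eq_of_past_demands (n m : ℕ) (μD σD μL σL : ℝ) :
    BMiid n m μD σD μL σL = 1 + 2 * μD ^ 2 * σL ^ 2 / ((m : ℝ) ^ 2 * σD ^ 2)
      + 2 * σL ^ 2 / (m : ℝ) ^ 2 * ((((m : ℝ) - 1) + n) / (n : ℝ) ^ 2)
      + 2 * μL * ((μL + n) / (n : ℝ) ^ 2) := by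
  unfold BMiid
  ring

theorem BMiid_eq_of_past_lead_times (n m : ℕ) (μD σD μL σL : ℝ) :
    BMiid n m μD σD μL σL = 1 + 2 * μD ^ 2 * σL ^ 2 / σD ^ 2 / (m : ℝ) ^ 2
      + 2 * σL ^ 2 / (n : ℝ) ^ 2 * ((((n : ℝ) - 1) + m) / (m : ℝ) ^ 2)
      + 2 * μL * (μL + n) / (n : ℝ) ^ 2 := by
  unfold BMiid
  ring

/-- If `μ_L > 0` or `σ_L > 0`, the i.i.d.-demand bullwhip measure is strictly
decreasing in `n`; if `σ_L > 0` it is strictly decreasing in `m`. -/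
theorem bullwhip_iid_strict_anti (μD σD μL σL : ℝ) (hσD : 0 < σD) (hμL : 0 ≤ μL)
    (hσL : 0 ≤ σL) :
    ((0 < μL ∨ 0 < σL) → ∀ m : ℕ, 1 ≤ m → ∀ n₁ n₂ : ℕ, 1 ≤ n₁ → n₁ < n₂ →
        BMiid n₂ m μD σD μL σL < BMiid n₁ m μD σD μL σL) ∧
      (0 < σL → ∀ n : ℕ, 1 ≤ n → ∀ m₁ m₂ : ℕ, 1 ≤ m₁ → m₁ < m₂ →
        BMiid n m₂ μD σD μL σL < BMiid n m₁ μD σD μL σL) := by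
  refine ⟨fun h m hm n₁ n₂ hn₁ hn => ?_, fun h n hn m₁ m₂ hm₁ hm => ?_⟩
  · have hm' : (1 : ℝ) ≤ m := by exact_mod_cast hm
    have hm₀ : (0 : ℝ) < m := by linarith
    have hn₁' : (0 : ℝ) < n₁ := by exact_mod_cast hn₁
    have hn' : (n₁ : ℝ) < n₂ := by exact_mod_cast hn
    have hσ := add_div_sq_lt_add_div_sq (sub_nonneg.2 hm') hn₁' hn'
    have hμ := add_div_sq_lt_add_div_sq hμL hn₁' hn'
    rw [BMiid_eq_of_past_demands, BMiid_eq_of_past_demands]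
    rcases h with h | h
    · exact add_lt_add_of_le_of_lt
        (add_le_add_right (mul_le_mul_of_nonneg_left hσ.le (by positivity)) _)
        (mul_lt_mul_of_pos_left hμ (by positivity))
    · exact add_lt_add_of_lt_of_le
        (add_lt_add_right (mul_lt_mul_of_pos_left hσ (by positivity)) _)
        (mul_le_mul_of_nonneg_left hμ.le (by positivity))
  · have hn' : (1 : ℝ) ≤ n := by exact_mod_cast hn
    have hn₀ : (0 : ℝ) < n := by linarith
    have hm₁' : (0 : ℝ) < m₁ := by exact_mod_cast hm₁
    have hm' : (m₁ : ℝ) < m₂ := by exact_mod_cast hm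
    have hσ := mul_lt_mul_of_pos_left
      (add_div_sq_lt_add_div_sq (sub_nonneg.2 hn') hm₁' hm')
      (show 0 < 2 * σL ^ 2 / (n : ℝ) ^ 2 by positivity)
    have hD : 2 * μD ^ 2 * σL ^ 2 / σD ^ 2 / (m₂ : ℝ) ^ 2
        ≤ 2 * μD ^ 2 * σL ^ 2 / σD ^ 2 / (m₁ : ℝ) ^ 2 := by gcongr
    rw [BMiid_eq_of_past_lead_times, BMiid_eq_of_past_lead_times]
    linarith
end

section
/- For fixed n ≥ 1 and m ≥ 1, the limit of the bullwhip measure as ρ → 1⁻ exists and equals BM_{ρ→1} := 1 + 2σ_L²(μ_D² + σ_D²)/(m²σ_D²); in particular this limit is independent of n. -/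
open Filter Topology

/-- The part of the bullwhip measure that is singular at `ρ = 1` agrees with a polynomial. -/
theorem bullwhip_singular_part_eq (n : ℕ) {ρ : ℝ} (hρ : ρ ≠ 1) :
    (n : ℝ) * (1 + ρ) / (1 - ρ) - (1 + ρ ^ 2) * (1 - ρ ^ n) / (1 - ρ) ^ 2 =
      n * ρ + (1 + ρ ^ 2) * ∑ i ∈ Finset.range n, ∑ j ∈ Finset.range i, ρ ^ j := by
  have h : 1 - ρ ≠ 0 := sub_ne_zero.mpr hρ.symm
  have hgeom : 1 - ρ ^ n = (1 - ρ) * ∑ i ∈ Finset.range n, ρ ^ i :=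
    (mul_neg_geom_sum ρ n).symm
  have hdouble : ∑ i ∈ Finset.range n, ρ ^ i =
      n - (1 - ρ) * ∑ i ∈ Finset.range n, ∑ j ∈ Finset.range i, ρ ^ j := by
    rw [Finset.mul_sum]
    simp [mul_neg_geom_sum]
  rw [hgeom, hdouble]
  field_simp
  ring

/-- The polynomial form of the singular part takes the value `n ^ 2` at `ρ = 1`. -/
theorem bullwhip_singular_part_one (n : ℕ) :
    (n : ℝ) * 1 + (1 + 1 ^ 2) * ∑ i ∈ Finset.range n, ∑ j ∈ Finset.range i, (1 : ℝ) ^ j =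
      (n : ℝ) ^ 2 := by
  induction n with
  | zero => simp
  | succ k ih =>
    rw [Finset.sum_range_succ]
    simp only [one_pow, Finset.sum_const, Finset.card_range, nsmul_eq_mul] at ih ⊢
    push_cast
    linear_combination ih

/-- As `ρ → 1⁻` the bullwhip measure tends to `1 + 2σ_L²(μ_D² + σ_D²)/(m²σ_D²)`,
a limit independent of `n`. -/
theorem bullwhip_limit_rho_one (n m : ℕ) (hn : 1 ≤ n) (hm : 1 ≤ m) (μD σD μL σL : ℝ)
    (hσD : 0 < σD) (hμL : 0 ≤ μL) (hσL : 0 ≤ σL) :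
    Tendsto (fun ρ : ℝ => BM ρ n m μD σD μL σL) (𝓝[<] 1)
      (𝓝 (1 + 2 * σL ^ 2 * (μD ^ 2 + σD ^ 2) / ((m : ℝ) ^ 2 * σD ^ 2))) := by
  have hn' : (n : ℝ) ≠ 0 := by positivity
  have hm' : (m : ℝ) ≠ 0 := by positivity
  let f : ℝ → ℝ := fun ρ =>
    (2 * σL ^ 2 / ((n : ℝ) ^ 2 * (m : ℝ) ^ 2)) *
        ((m : ℝ) * (1 - ρ ^ n) +
          (n * ρ + (1 + ρ ^ 2) * ∑ i ∈ Finset.range n, ∑ j ∈ Finset.range i, ρ ^ j))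
      + 2 * σL ^ 2 * μD ^ 2 / (σD ^ 2 * (m : ℝ) ^ 2)
      + (2 * μL ^ 2 / (n : ℝ) ^ 2 + 2 * μL / (n : ℝ)) * (1 - ρ ^ n) + 1
  have hf : Continuous f := by fun_prop
  have hf1 : f 1 = 1 + 2 * σL ^ 2 * (μD ^ 2 + σD ^ 2) / ((m : ℝ) ^ 2 * σD ^ 2) := by
    simp only [f]
    rw [bullwhip_singular_part_one, one_pow]
    field_simp
    ring
  rw [← hf1]
  refine ((hf.tendsto 1).mono_left nhdsWithin_le_nhds).congr' ?_
  filter_upwards [self_mem_nhdsWithin] with ρ hρ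
  simp only [f, BM]
  rw [← bullwhip_singular_part_eq n (ne_of_lt hρ), add_sub_assoc]
end

section
/- Suppose σ_L > 0. If n ≤ (σ_L² + m²μ_L + √((σ_L² + m²μ_L)² + 4σ_L²(σ_L²(m−1) + m²μ_L²)))/(2σ_L²), then BM_iid ≥ BM_{ρ→1}, where BM_iid = 1 + 2μ_D²σ_L²/(m²σ_D²) + 2σ_L²(m+n−1)/(m²n²) + 2μ_L(μ_L+n)/n² and BM_{ρ→1} = 1 + 2σ_L²(μ_D² + σ_D²)/(m²σ_D²). -/
/-- A nonnegative number at most the larger root of `a x² - b x - c`, where `a > 0` and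
`c ≥ 0`, makes this quadratic nonpositive. -/
theorem mul_sq_le_of_le_larger_root {a b c x : ℝ} (ha : 0 < a) (hc : 0 ≤ c)
    (hx : 0 ≤ x) (h : x ≤ (b + Real.sqrt (b ^ 2 + 4 * a * c)) / (2 * a)) :
    a * x ^ 2 ≤ b * x + c := by
  rw [le_div_iff₀ (by positivity)] at h
  have hs : b ≤ Real.sqrt (b ^ 2 + 4 * a * c) :=
    Real.le_sqrt_of_sq_le (le_add_of_nonneg_right (by positivity))
  have hsq := Real.sq_sqrt (show 0 ≤ b ^ 2 + 4 * a * c by positivity)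
  have hax : 0 ≤ a * x := by positivity
  have key : (2 * a * x - b) ^ 2 ≤ Real.sqrt (b ^ 2 + 4 * a * c) ^ 2 :=
    sq_le_sq' (by linarith) (by linarith)
  rw [hsq] at key
  refine le_of_mul_le_mul_left ?_ (show 0 < 4 * a by positivity)
  linarith


/-- If `σ_L > 0` and
`n ≤ (σ_L² + m²μ_L + √((σ_L² + m²μ_L)² + 4σ_L²(σ_L²(m-1) + m²μ_L²)))/(2σ_L²)`,
then `BM_iid ≥ BM_{ρ→1}`. -/
theorem bullwhip_iid_ge_limit_rho_one (n m : ℕ) (hn : 1 ≤ n) (hm : 1 ≤ m)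
    (μD σD μL σL : ℝ) (hσD : 0 < σD) (hμL : 0 ≤ μL) (hσL : 0 < σL)
    (hcond : (n : ℝ) ≤ (σL ^ 2 + (m : ℝ) ^ 2 * μL +
        Real.sqrt ((σL ^ 2 + (m : ℝ) ^ 2 * μL) ^ 2 +
          4 * σL ^ 2 * (σL ^ 2 * ((m : ℝ) - 1) + (m : ℝ) ^ 2 * μL ^ 2))) / (2 * σL ^ 2)) :
    1 + 2 * μD ^ 2 * σL ^ 2 / ((m : ℝ) ^ 2 * σD ^ 2)
        + 2 * σL ^ 2 * ((m : ℝ) + (n : ℝ) - 1) / ((m : ℝ) ^ 2 * (n : ℝ) ^ 2)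
        + 2 * μL * (μL + (n : ℝ)) / (n : ℝ) ^ 2 ≥
      1 + 2 * σL ^ 2 * (μD ^ 2 + σD ^ 2) / ((m : ℝ) ^ 2 * σD ^ 2) := by
  have hn' : (1 : ℝ) ≤ n := by exact_mod_cast hn
  have hm' : (1 : ℝ) ≤ m := by exact_mod_cast hm
  have hm₁ : (0 : ℝ) ≤ (m : ℝ) - 1 := by linarith
  have hn₀ : (0 : ℝ) < n := by linarith
  have hm₀ : (0 : ℝ) < m := by linarith
  have hquad := mul_sq_le_of_le_larger_root (by positivity) (by positivity)
    hn₀.le hcond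
  rw [ge_iff_le, ← sub_nonneg]
  have hdiff : 1 + 2 * μD ^ 2 * σL ^ 2 / ((m : ℝ) ^ 2 * σD ^ 2)
        + 2 * σL ^ 2 * ((m : ℝ) + (n : ℝ) - 1) / ((m : ℝ) ^ 2 * (n : ℝ) ^ 2)
        + 2 * μL * (μL + (n : ℝ)) / (n : ℝ) ^ 2
        - (1 + 2 * σL ^ 2 * (μD ^ 2 + σD ^ 2) / ((m : ℝ) ^ 2 * σD ^ 2)) =
      2 * ((σL ^ 2 + (m : ℝ) ^ 2 * μL) * n + (σL ^ 2 * ((m : ℝ) - 1) + (m : ℝ) ^ 2 * μL ^ 2)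
        - σL ^ 2 * (n : ℝ) ^ 2) / ((m : ℝ) ^ 2 * (n : ℝ) ^ 2) := by
    field_simp
    ring
  rw [hdiff]
  exact div_nonneg (by linarith) (by positivity)
end

section
/- For fixed n ≥ 1 and m ≥ 1, the limit of the bullwhip measure as ρ → −1⁺ exists and equals BM_{ρ→−1} := 1 + 2μ_D²σ_L²/(m²σ_D²) − (2m−1)((−1)ⁿ − 1)σ_L²/(m²n²) − 2((−1)ⁿ − 1)μ_L(μ_L+n)/n². In particular, if n is even then BM_{ρ→−1} = 1 + 2μ_D²σ_L²/(m²σ_D²), and if n is odd then BM_{ρ→−1} = 1 + 2μ_D²σ_L²/(m²σ_D²) + 2(2m−1)σ_L²/(m²n²) + 4μ_L(μ_L+n)/n². -/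
open Filter Topology

/-- As `ρ → -1⁺` the bullwhip measure tends to
`1 + 2μ_D²σ_L²/(m²σ_D²) - (2m-1)((-1)ⁿ-1)σ_L²/(m²n²) - 2((-1)ⁿ-1)μ_L(μ_L+n)/n²`,
with the indicated simplifications for even and odd `n`. -/
theorem bullwhip_limit_rho_neg_one (n m : ℕ) (hn : 1 ≤ n) (hm : 1 ≤ m) (μD σD μL σL : ℝ)
    (hσD : 0 < σD) (hμL : 0 ≤ μL) (hσL : 0 ≤ σL) :
    Tendsto (fun ρ : ℝ => BM ρ n m μD σD μL σL) (𝓝[>] (-1))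
        (𝓝 (1 + 2 * μD ^ 2 * σL ^ 2 / ((m : ℝ) ^ 2 * σD ^ 2)
          - (2 * (m : ℝ) - 1) * ((-1 : ℝ) ^ n - 1) * σL ^ 2 / ((m : ℝ) ^ 2 * (n : ℝ) ^ 2)
          - 2 * ((-1 : ℝ) ^ n - 1) * μL * (μL + (n : ℝ)) / (n : ℝ) ^ 2)) ∧
      (Even n →
        1 + 2 * μD ^ 2 * σL ^ 2 / ((m : ℝ) ^ 2 * σD ^ 2)
          - (2 * (m : ℝ) - 1) * ((-1 : ℝ) ^ n - 1) * σL ^ 2 / ((m : ℝ) ^ 2 * (n : ℝ) ^ 2)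
          - 2 * ((-1 : ℝ) ^ n - 1) * μL * (μL + (n : ℝ)) / (n : ℝ) ^ 2 =
        1 + 2 * μD ^ 2 * σL ^ 2 / ((m : ℝ) ^ 2 * σD ^ 2)) ∧
      (Odd n →
        1 + 2 * μD ^ 2 * σL ^ 2 / ((m : ℝ) ^ 2 * σD ^ 2)
          - (2 * (m : ℝ) - 1) * ((-1 : ℝ) ^ n - 1) * σL ^ 2 / ((m : ℝ) ^ 2 * (n : ℝ) ^ 2)
          - 2 * ((-1 : ℝ) ^ n - 1) * μL * (μL + (n : ℝ)) / (n : ℝ) ^ 2 =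
        1 + 2 * μD ^ 2 * σL ^ 2 / ((m : ℝ) ^ 2 * σD ^ 2)
          + 2 * (2 * (m : ℝ) - 1) * σL ^ 2 / ((m : ℝ) ^ 2 * (n : ℝ) ^ 2)
          + 4 * μL * (μL + (n : ℝ)) / (n : ℝ) ^ 2) := by
  have hn0 : (n : ℝ) ≠ 0 := by positivity
  have hm0 : (m : ℝ) ≠ 0 := by positivity
  refine ⟨?_, fun h => ?_, fun h => ?_⟩
  · have hc : ContinuousAt (fun ρ : ℝ => BM ρ n m μD σD μL σL) (-1) := by
      unfold BM
      have h1 : (1 - (-1 : ℝ)) ≠ 0 := by norm_num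
      have h2 : (1 - (-1 : ℝ)) ^ 2 ≠ 0 := by norm_num
      fun_prop (disch := assumption)
    convert hc.tendsto.mono_left nhdsWithin_le_nhds using 2
    unfold BM
    field_simp
    ring
  · rw [h.neg_one_pow]
    ring
  · rw [h.neg_one_pow]
    ring
end

section
/- Suppose μ_L > 0 and n is odd. If m ≥ (σ_L·√(σ_L² + 4nμ_L(μ_L+n)) − σ_L²)/(2μ_L(μ_L+n)), then BM_iid ≤ BM_{ρ→−1, odd n}, where BM_iid = 1 + 2μ_D²σ_L²/(m²σ_D²) + 2σ_L²(m+n−1)/(m²n²) + 2μ_L(μ_L+n)/n² and BM_{ρ→−1, odd n} = 1 + 2μ_D²σ_L²/(m²σ_D²) + 2(2m−1)σ_L²/(m²n²) + 4μ_L(μ_L+n)/n². -/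
/-- A real `x` at least the larger root `(s √(s² + 4na) - s²)/(2a)` of the quadratic
`a x² + s² x - n s²` makes it nonnegative. -/
lemma quadratic_nonneg_of_root_le {a s n x : ℝ} (ha : 0 < a) (hs : 0 ≤ s) (hn : 0 ≤ n)
    (hx : (s * √(s ^ 2 + 4 * n * a) - s ^ 2) / (2 * a) ≤ x) :
    0 ≤ a * x ^ 2 + s ^ 2 * x - n * s ^ 2 := by
  rw [div_le_iff₀ (by positivity)] at hx
  have hsq : (s * √(s ^ 2 + 4 * n * a)) ^ 2 = s ^ 2 * (s ^ 2 + 4 * n * a) := by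
    rw [mul_pow, Real.sq_sqrt (by positivity)]
  have hle : (s * √(s ^ 2 + 4 * n * a)) ^ 2 ≤ (2 * a * x + s ^ 2) ^ 2 :=
    pow_le_pow_left₀ (by positivity) (by linarith) 2
  refine nonneg_of_mul_nonneg_right (a := 4 * a) ?_ (by positivity)
  linarith

/-- If `μ_L > 0`, `n` is odd and
`m ≥ (σ_L √(σ_L² + 4nμ_L(μ_L+n)) - σ_L²)/(2μ_L(μ_L+n))`, then
`BM_iid ≤ BM_{ρ→-1, odd n}`. -/
theorem bullwhip_iid_le_limit_rho_neg_one (n m : ℕ) (hn : 1 ≤ n) (hm : 1 ≤ m)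
    (hodd : Odd n) (μD σD μL σL : ℝ) (hσD : 0 < σD) (hμL : 0 < μL) (hσL : 0 ≤ σL)
    (hcond : (m : ℝ) ≥ (σL * Real.sqrt (σL ^ 2 + 4 * (n : ℝ) * μL * (μL + (n : ℝ)))
        - σL ^ 2) / (2 * μL * (μL + (n : ℝ)))) :
    1 + 2 * μD ^ 2 * σL ^ 2 / ((m : ℝ) ^ 2 * σD ^ 2)
        + 2 * σL ^ 2 * ((m : ℝ) + (n : ℝ) - 1) / ((m : ℝ) ^ 2 * (n : ℝ) ^ 2)
        + 2 * μL * (μL + (n : ℝ)) / (n : ℝ) ^ 2 ≤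
      1 + 2 * μD ^ 2 * σL ^ 2 / ((m : ℝ) ^ 2 * σD ^ 2)
        + 2 * (2 * (m : ℝ) - 1) * σL ^ 2 / ((m : ℝ) ^ 2 * (n : ℝ) ^ 2)
        + 4 * μL * (μL + (n : ℝ)) / (n : ℝ) ^ 2 := by
  have hn' : (0 : ℝ) < n := by exact_mod_cast hn
  have hm' : (0 : ℝ) < m := by exact_mod_cast hm
  have hquad : 0 ≤ μL * (μL + n) * (m : ℝ) ^ 2 + σL ^ 2 * m - n * σL ^ 2 :=
    quadratic_nonneg_of_root_le (by positivity) hσL hn'.le (by simpa only [mul_assoc] using hcond)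
  rw [← sub_nonneg]
  have hdiff : 0 ≤ 2 * (μL * (μL + n) * (m : ℝ) ^ 2 + σL ^ 2 * m - n * σL ^ 2)
      / ((m : ℝ) ^ 2 * (n : ℝ) ^ 2) := by positivity
  convert hdiff using 1
  field_simp
  ring
end

section
/- Suppose n is odd with n > 1, σ_L > 0, μ_L > 0, and m ≥ (σ_L·√(σ_L² + 4nμ_L(μ_L+n)) − σ_L²)/(2μ_L(μ_L+n)). Then the function ρ ↦ BM(ρ, n, m) has at least one stationary point in (−1, 0): there exists ρ* ∈ (−1, 0) with d BM(ρ, n, m)/dρ |_{ρ=ρ*} = 0. -/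
open Filter Topology

/-- The derivative of the bullwhip measure in the autocorrelation. -/
theorem hasDerivAt_BM (n m : ℕ) (μD σD μL σL ρ : ℝ) (hρ : ρ ≠ 1) :
    HasDerivAt (fun ρ : ℝ => BM ρ n m μD σD μL σL)
      ((2 * σL ^ 2 / ((n : ℝ) ^ 2 * (m : ℝ) ^ 2)) *
        (-(m * (n * ρ ^ (n - 1))) + 2 * n / (1 - ρ) ^ 2
          - ((2 * ρ * (1 - ρ ^ n) - (1 + ρ ^ 2) * (n * ρ ^ (n - 1))) / (1 - ρ) ^ 2
            + 2 * (1 + ρ ^ 2) * (1 - ρ ^ n) / (1 - ρ) ^ 3))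
        + (2 * μL ^ 2 / (n : ℝ) ^ 2 + 2 * μL / (n : ℝ)) * -(n * ρ ^ (n - 1))) ρ := by
  have h1 : 1 - ρ ≠ 0 := sub_ne_zero.mpr hρ.symm
  have hid := hasDerivAt_id' ρ
  have hsub : HasDerivAt (fun x : ℝ => 1 - x) (-1) ρ := hid.const_sub 1
  have hpow : HasDerivAt (fun x : ℝ => 1 - x ^ n) (-(n * ρ ^ (n - 1))) ρ :=
    (hasDerivAt_pow n ρ).const_sub 1
  have hsq : HasDerivAt (fun x : ℝ => 1 + x ^ 2) (2 * ρ) ρ := by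
    simpa using (hasDerivAt_pow 2 ρ).const_add 1
  have hsubsq : HasDerivAt (fun x : ℝ => (1 - x) ^ 2) (-(2 * (1 - ρ))) ρ := by
    simpa using hsub.fun_pow 2
  have hfrac := ((hid.const_add 1).const_mul (n : ℝ)).fun_div hsub h1
  have hquot := (hsq.fun_mul hpow).fun_div hsubsq (pow_ne_zero 2 h1)
  have hBM := (((((hpow.const_mul (m : ℝ)).fun_add hfrac).fun_sub hquot).const_mul
    (2 * σL ^ 2 / ((n : ℝ) ^ 2 * (m : ℝ) ^ 2))).add_const
      (2 * σL ^ 2 * μD ^ 2 / (σD ^ 2 * (m : ℝ) ^ 2))).fun_add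
        (hpow.const_mul (2 * μL ^ 2 / (n : ℝ) ^ 2 + 2 * μL / (n : ℝ))) |>.add_const 1
  refine hBM.congr_deriv ?_
  congr 2
  field_simp
  ring

/-- For odd `n > 1`, `σ_L > 0`, `μ_L > 0` and
`m ≥ (σ_L √(σ_L² + 4nμ_L(μ_L+n)) - σ_L²)/(2μ_L(μ_L+n))`, the bullwhip measure
has a stationary point in `(-1, 0)`. -/
theorem bullwhip_stationary_point_neg (n m : ℕ) (hn : 1 < n) (hodd : Odd n) (hm : 1 ≤ m)
    (μD σD μL σL : ℝ) (hσD : 0 < σD) (hμL : 0 < μL) (hσL : 0 < σL)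
    (hcond : (m : ℝ) ≥ (σL * Real.sqrt (σL ^ 2 + 4 * (n : ℝ) * μL * (μL + (n : ℝ)))
        - σL ^ 2) / (2 * μL * (μL + (n : ℝ)))) :
    ∃ ρstar ∈ Set.Ioo (-1 : ℝ) 0,
      deriv (fun ρ : ℝ => BM ρ n m μD σD μL σL) ρstar = 0 := by
  have hderiv : ∀ ρ ∈ Set.Icc (-1 : ℝ) 0, HasDerivWithinAt (fun ρ : ℝ => BM ρ n m μD σD μL σL)
      _ (Set.Icc (-1) 0) ρ := fun ρ hρ =>
    (hasDerivAt_BM n m μD σD μL σL ρ (by linarith [hρ.2])).hasDerivWithinAt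
  have hn' : (1 : ℝ) < n := by exact_mod_cast hn
  have hm' : (1 : ℝ) ≤ m := by exact_mod_cast hm
  have hmem := exists_hasDerivWithinAt_eq_of_gt_of_lt
    (by norm_num) hderiv (m := (0 : ℝ)) ?_ ?_
  · obtain ⟨ρ, hρ, hzero⟩ := hmem
    exact ⟨ρ, hρ, (hasDerivAt_BM n m μD σD μL σL ρ (by linarith [hρ.2])).deriv.trans hzero⟩
  · have heven : Even (n - 1) := hodd.tsub_odd odd_one
    rw [hodd.neg_one_pow, heven.neg_one_pow]
    have hcoef : 0 < 2 * σL ^ 2 / ((n : ℝ) ^ 2 * (m : ℝ) ^ 2) := by positivity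
    have hlead : 0 < (2 * μL ^ 2 / (n : ℝ) ^ 2 + 2 * μL / (n : ℝ)) * n := by positivity
    have hle : (n : ℝ) * (1 - m) ≤ 0 := by nlinarith
    have := mul_nonpos_of_nonneg_of_nonpos hcoef.le hle
    norm_num
    ring_nf at this hlead ⊢
    linarith
  · have hcoef : 0 < 2 * σL ^ 2 / ((n : ℝ) ^ 2 * (m : ℝ) ^ 2) := by positivity
    rw [zero_pow (by omega : n ≠ 0), zero_pow (by omega : n - 1 ≠ 0)]
    have := mul_pos hcoef (by linarith : (0 : ℝ) < 2 * n - 2)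
    norm_num
    linarith
end

section
/- Suppose n ≥ 2, σ_L > 0, and n ≤ (σ_L² + m²μ_L + √((σ_L² + m²μ_L)² + 4σ_L²(σ_L²(m−1) + m²μ_L²)))/(2σ_L²). Then the function ρ ↦ BM(ρ, n, m) has at least one stationary point in (0, 1): there exists ρ* ∈ (0, 1) with d BM(ρ, n, m)/dρ |_{ρ=ρ*} = 0. -/
open Filter Topology

open Polynomial in
/-- The polynomial extending `n(1+x)/(1-x) - (1+x²)(1-xⁿ)/(1-x)²` across `x = 1`. -/
noncomputable def bracketPoly (n : ℕ) : ℝ[X] :=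
  ∑ k ∈ Finset.range n, (∑ i ∈ Finset.range k, X ^ i + X * ∑ i ∈ Finset.range (k + 1), X ^ i)

open Polynomial in
theorem bracketPoly_succ (n : ℕ) : bracketPoly (n + 1) = bracketPoly n +
    (∑ i ∈ Finset.range n, X ^ i + X * ∑ i ∈ Finset.range (n + 1), X ^ i) :=
  Finset.sum_range_succ _ _

theorem bracketPoly_eval (n : ℕ) {x : ℝ} (hx : x ≠ 1) :
    (bracketPoly n).eval x =
      (n : ℝ) * (1 + x) / (1 - x) - (1 + x ^ 2) * (1 - x ^ n) / (1 - x) ^ 2 := by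
  have h : 1 - x ≠ 0 := sub_ne_zero.mpr hx.symm
  have h' : x - 1 ≠ 0 := sub_ne_zero.mpr hx
  induction n with
  | zero => simp [bracketPoly]
  | succ n ih =>
    have geom (k : ℕ) : ∑ i ∈ Finset.range k, x ^ i = (1 - x ^ k) / (1 - x) := by
      rw [geom_sum_eq hx, ← neg_div_neg_eq, neg_sub, neg_sub]
    simp only [bracketPoly_succ, Polynomial.eval_add, ih, Polynomial.eval_mul,
      Polynomial.eval_finsetSum, Polynomial.eval_pow, Polynomial.eval_X, geom]
    push_cast
    field_simp
    ring

open Polynomial in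
theorem eval_one_derivative_geom_sum (n : ℕ) :
    (derivative (∑ i ∈ Finset.range n, (X : ℝ[X]) ^ i)).eval 1 = (n : ℝ) * (n - 1) / 2 := by
  induction n with
  | zero => simp
  | succ n ih =>
    rw [Finset.sum_range_succ, derivative_add, eval_add, ih]
    simp [derivative_X_pow]
    ring

theorem eval_one_derivative_bracketPoly (n : ℕ) :
    (Polynomial.derivative (bracketPoly n)).eval 1 = (n : ℝ) * (n ^ 2 + 2) / 3 := by
  induction n with
  | zero => simp [bracketPoly]
  | succ n ih =>
    rw [bracketPoly_succ, Polynomial.derivative_add, Polynomial.derivative_add,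
      Polynomial.derivative_mul]
    simp only [Polynomial.eval_add, Polynomial.eval_mul, ih, eval_one_derivative_geom_sum]
    simp [Polynomial.eval_finsetSum]
    ring

open Polynomial in
theorem eval_zero_derivative_geom_sum_nonneg (n : ℕ) :
    0 ≤ (derivative (∑ i ∈ Finset.range n, (X : ℝ[X]) ^ i)).eval 0 := by
  rw [derivative_sum, eval_finsetSum]
  refine Finset.sum_nonneg fun i _ => ?_
  simp only [derivative_X_pow, eval_mul, eval_pow, eval_X, map_natCast, eval_natCast]
  positivity

theorem le_eval_zero_derivative_bracketPoly (n : ℕ) :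
    (n : ℝ) ≤ (Polynomial.derivative (bracketPoly n)).eval 0 := by
  induction n with
  | zero => simp [bracketPoly]
  | succ n ih =>
    have h := eval_zero_derivative_geom_sum_nonneg n
    rw [bracketPoly_succ, Polynomial.derivative_add, Polynomial.derivative_add,
      Polynomial.derivative_mul]
    have h1 : (∑ i ∈ Finset.range (n + 1), (Polynomial.X : Polynomial ℝ) ^ i).eval 0 = 1 := by
      simp [Finset.sum_range_succ', Polynomial.eval_finsetSum]
    simp only [Polynomial.eval_add, Polynomial.eval_mul, Polynomial.derivative_X,
      Polynomial.eval_one, Polynomial.eval_X, h1]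
    push_cast
    linarith

/-- The quadratic `s x² - b x - c` is nonpositive between `0` and its larger root. -/
theorem quadratic_nonpos_of_le_root {s b c x : ℝ} (hs : 0 < s) (hc : 0 ≤ c) (hx : 0 ≤ x)
    (h : x ≤ (b + Real.sqrt (b ^ 2 + 4 * s * c)) / (2 * s)) :
    s * x ^ 2 - b * x - c ≤ 0 := by
  have hD : 0 ≤ b ^ 2 + 4 * s * c := by positivity
  have hr := Real.sq_sqrt hD
  set r := Real.sqrt (b ^ 2 + 4 * s * c)
  have hbr : |b| ≤ r := Real.abs_le_sqrt (by nlinarith [mul_nonneg hs.le hc])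
  rw [le_div_iff₀ (by positivity)] at h
  have hb := (abs_le.mp hbr).2
  have h2 : 0 ≤ s * x := mul_nonneg hs.le hx
  nlinarith [mul_nonneg (sub_nonneg.mpr h) (show 0 ≤ 2 * s * x - b + r by linarith)]

/-- For `n ≥ 2`, `σ_L > 0` and
`n ≤ (σ_L² + m²μ_L + √((σ_L² + m²μ_L)² + 4σ_L²(σ_L²(m-1) + m²μ_L²)))/(2σ_L²)`,
the bullwhip measure has a stationary point in `(0, 1)`. -/
theorem bullwhip_stationary_point_pos (n m : ℕ) (hn : 2 ≤ n) (hm : 1 ≤ m)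
    (μD σD μL σL : ℝ) (hσD : 0 < σD) (hμL : 0 ≤ μL) (hσL : 0 < σL)
    (hcond : (n : ℝ) ≤ (σL ^ 2 + (m : ℝ) ^ 2 * μL +
        Real.sqrt ((σL ^ 2 + (m : ℝ) ^ 2 * μL) ^ 2 +
          4 * σL ^ 2 * (σL ^ 2 * ((m : ℝ) - 1) + (m : ℝ) ^ 2 * μL ^ 2))) / (2 * σL ^ 2)) :
    ∃ ρstar ∈ Set.Ioo (0 : ℝ) 1,
      deriv (fun ρ : ℝ => BM ρ n m μD σD μL σL) ρstar = 0 := by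
  have hn0 : (2 : ℝ) ≤ n := by exact_mod_cast hn
  have hm0 : (1 : ℝ) ≤ m := by exact_mod_cast hm
  have hquad := quadratic_nonpos_of_le_root (pow_pos hσL 2)
    (add_nonneg (mul_nonneg (sq_nonneg σL) (sub_nonneg.mpr hm0)) (by positivity))
    (by positivity) hcond
  set A : ℝ := 2 * σL ^ 2 / ((n : ℝ) ^ 2 * (m : ℝ) ^ 2) with hA
  set B : ℝ := 2 * μL ^ 2 / (n : ℝ) ^ 2 + 2 * μL / (n : ℝ) with hB
  have hApos : 0 < A := by positivity
  let Q : Polynomial ℝ := Polynomial.C A * bracketPoly n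
    + Polynomial.C (A * m + B) * (1 - Polynomial.X ^ n)
    + Polynomial.C (2 * σL ^ 2 * μD ^ 2 / (σD ^ 2 * (m : ℝ) ^ 2) + 1)
  have hQ' (x : ℝ) : Q.derivative.eval x =
      A * (bracketPoly n).derivative.eval x - (A * m + B) * (n * x ^ (n - 1)) := by
    simp [Q, Polynomial.derivative_X_pow]
    ring
  have hpos : 0 < Q.derivative.eval 0 := by
    rw [hQ', zero_pow (by omega)]
    have := mul_pos hApos (lt_of_lt_of_le (by linarith) (le_eval_zero_derivative_bracketPoly n))
    linarith
  have hneg : Q.derivative.eval 1 < 0 := by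
    rw [hQ', eval_one_derivative_bracketPoly, one_pow]
    have hAB : A * ((n : ℝ) ^ 2 - n + 1) ≤ A * m + B := by
      have : A * ((n : ℝ) ^ 2 - n + 1) - (A * m + B) =
          2 / ((n : ℝ) ^ 2 * (m : ℝ) ^ 2) * (σL ^ 2 * (n : ℝ) ^ 2
            - (σL ^ 2 + (m : ℝ) ^ 2 * μL) * n
            - (σL ^ 2 * ((m : ℝ) - 1) + (m : ℝ) ^ 2 * μL ^ 2)) := by
        rw [hA, hB]
        field_simp
        ring
      have := mul_nonpos_of_nonneg_of_nonpos
        (show 0 ≤ 2 / ((n : ℝ) ^ 2 * (m : ℝ) ^ 2) by positivity) hquad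
      linarith
    have hlt : A * (((n : ℝ) ^ 2 + 2) / 3) < A * ((n : ℝ) ^ 2 - n + 1) :=
      mul_lt_mul_of_pos_left (by nlinarith) hApos
    have := mul_lt_mul_of_pos_left (hlt.trans_le hAB) (show (0 : ℝ) < n by linarith)
    linarith
  obtain ⟨x, hx, hx0⟩ := intermediate_value_Ioo' zero_le_one
    (Polynomial.continuous Q.derivative).continuousOn ⟨hneg, hpos⟩
  refine ⟨x, hx, ?_⟩
  have hev : (fun ρ : ℝ => BM ρ n m μD σD μL σL) =ᶠ[𝓝 x] fun ρ => Q.eval ρ := by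
    filter_upwards [Iio_mem_nhds hx.2] with ρ hρ
    simp only [Q, BM, Polynomial.eval_add, Polynomial.eval_mul, Polynomial.eval_C,
      Polynomial.eval_sub, Polynomial.eval_one, Polynomial.eval_pow, Polynomial.eval_X,
      bracketPoly_eval n (ne_of_lt hρ), ← hA, ← hB]
    ring
  rw [hev.deriv_eq, Polynomial.deriv]
  exact hx0
end
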